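/- For every natural number k, there exist natural numbers a < b such that t_a and t_b are very triangular, t_j is not very triangular for all j with a < j < b, and b - a > k (i.e., there are at least k triangular numbers strictly between the consecutive very triangular numbers t_a and t_b). -/

import Mathlib

/-- The n-th triangular number. -/
def triangular (n : ℕ) : ℕ := n * (n + 1) / 2

/-- A natural number is triangular if it is `triangular n` for some `n`. -/
def IsTriangular (m : ℕ) : Prop := ∃ n : ℕ, triangular n = m

/-- The number of 1s in the binary representation of `m` (binary digit sum). -/
def binOnes (m : ℕ) : ℕ := (Nat.digits 2 m).sum

/-- A number is very triangular if it is triangular and its binary digit sum is triangular. -/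
def IsVeryTriangular (m : ℕ) : Prop := IsTriangular m ∧ IsTriangular (binOnes m)

theorem binOnes_zero : binOnes 0 = 0 := by simp [binOnes]

theorem binOnes_two_mul (n : ℕ) : binOnes (2 * n) = binOnes n := by
  rcases Nat.eq_zero_or_pos n with rfl | hn
  · rfl
  · unfold binOnes
    rw [Nat.digits_def' (by norm_num) (by omega)]
    simp

theorem binOnes_two_mul_add_one (n : ℕ) : binOnes (2 * n + 1) = binOnes n + 1 := by
  unfold binOnes
  rw [Nat.digits_def' (by norm_num) (by omega), show (2 * n + 1) % 2 = 1 by omega,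
    show (2 * n + 1) / 2 = n by omega, List.sum_cons, add_comm]

theorem binOnes_le (n : ℕ) : binOnes n ≤ n := Nat.digit_sum_le 2 n

theorem binOnes_two_pow_mul_add (e x : ℕ) :
    ∀ y < 2 ^ e, binOnes (2 ^ e * x + y) = binOnes x + binOnes y := by
  induction e with
  | zero =>
    intro y hy
    obtain rfl : y = 0 := by simpa using hy
    simp [binOnes_zero]
  | succ e ih =>
    intro y hy
    rw [pow_succ] at hy ⊢
    obtain ⟨z, rfl | rfl⟩ := Nat.even_or_odd' y
    · rw [show 2 ^ e * 2 * x + 2 * z = 2 * (2 ^ e * x + z) by ring, binOnes_two_mul,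
        binOnes_two_mul, ih z (by omega)]
    · rw [show 2 ^ e * 2 * x + (2 * z + 1) = 2 * (2 ^ e * x + z) + 1 by ring,
        binOnes_two_mul_add_one, binOnes_two_mul_add_one, ih z (by omega), add_assoc]

theorem binOnes_add_binOnes_of_add_eq (r : ℕ) :
    ∀ y z, y + z + 1 = 2 ^ r → binOnes y + binOnes z = r := by
  induction r with
  | zero =>
    intro y z h
    obtain ⟨rfl, rfl⟩ : y = 0 ∧ z = 0 := by constructor <;> simp at h <;> omega
    simp [binOnes_zero]
  | succ r ih =>
    intro y z h
    rw [pow_succ] at h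
    obtain ⟨u, rfl | rfl⟩ := Nat.even_or_odd' y <;> obtain ⟨v, rfl | rfl⟩ := Nat.even_or_odd' z
    · omega
    · rw [binOnes_two_mul, binOnes_two_mul_add_one, ← ih u v (by omega), add_assoc]
    · rw [binOnes_two_mul, binOnes_two_mul_add_one, ← ih u v (by omega)]
      ring
    · omega

/-- Every positive multiple of `2 ^ r - 1` by a factor at most `2 ^ r` has exactly `r` ones. -/
theorem binOnes_mul_of_add_one_eq_two_pow {A r x : ℕ} (hA : A + 1 = 2 ^ r) (hx : 0 < x)
    (hxr : x ≤ 2 ^ r) : binOnes (A * x) = r := by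
  obtain ⟨y, rfl⟩ : ∃ y, x = y + 1 := ⟨x - 1, by omega⟩
  obtain ⟨z, hz⟩ : ∃ z, y + z + 1 = 2 ^ r := ⟨2 ^ r - 1 - y, by omega⟩
  have h : A * (y + 1) = 2 ^ r * y + z := by
    obtain rfl : A = y + z := by omega
    rw [← hz]
    ring
  rw [h, binOnes_two_pow_mul_add _ _ _ (by omega), binOnes_add_binOnes_of_add_eq r y z hz]

theorem two_mul_triangular (n : ℕ) : 2 * triangular n = n * (n + 1) :=
  Nat.mul_div_cancel' (Nat.even_mul_succ_self n).two_dvd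

theorem triangular_succ (n : ℕ) : triangular (n + 1) = triangular n + (n + 1) := by
  have h₁ := two_mul_triangular n
  have h₂ := two_mul_triangular (n + 1)
  nlinarith

theorem triangular_monotone : Monotone triangular :=
  monotone_nat_of_le_succ fun n => by rw [triangular_succ]; omega

theorem le_triangular (n : ℕ) : n ≤ triangular n := by
  cases n with
  | zero => simp
  | succ n => rw [triangular_succ]; omega

theorem not_isTriangular_of_between {c m : ℕ} (h₁ : triangular c < m)
    (h₂ : m < triangular (c + 1)) : ¬ IsTriangular m := by
  rintro ⟨n, rfl⟩
  have := triangular_monotone.reflect_lt h₁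
  have := triangular_monotone.reflect_lt h₂
  omega

theorem exists_isVeryTriangular_ge (N : ℕ) : ∃ n ≥ N, IsVeryTriangular (triangular n) := by
  obtain ⟨m, hm⟩ : ∃ m, triangular (N + 1) = m + 1 :=
    ⟨triangular (N + 1) - 1, by have := le_triangular (N + 1); omega⟩
  obtain ⟨A, hA⟩ : ∃ A, A + 1 = 2 ^ (m + 1) :=
    ⟨2 ^ (m + 1) - 1, by have := Nat.one_le_two_pow (n := m + 1); omega⟩
  refine ⟨A, ?_, ⟨A, rfl⟩, N + 1, ?_⟩
  · have := le_triangular (N + 1)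
    have := Nat.lt_two_pow_self (n := m + 1)
    omega
  · have h : triangular A = 2 ^ m * A + 0 := by
      have := two_mul_triangular A
      rw [hA, pow_succ] at this
      linarith
    rw [h, binOnes_two_pow_mul_add _ _ _ (by positivity), binOnes_zero, hm, ← mul_one A,
      binOnes_mul_of_add_one_eq_two_pow hA one_pos Nat.one_le_two_pow, add_zero]

theorem binOnes_triangular_two_pow_mul_add {A r M j : ℕ} (hA : A + 1 = 2 ^ r) (hr : 0 < r)
    (hj : 2 * j + 1 ≤ 2 ^ r) (hM : 2 * r ≤ M) (hjM : triangular j < 2 ^ M) :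
    binOnes (triangular (2 ^ (M + 1) * A + j)) = 2 * r + binOnes (triangular j) := by
  have hA' : 0 < A := by
    have := Nat.lt_two_pow_self (n := r)
    omega
  have hlt : A * (2 * j + 1) < 2 ^ (M + 1) := calc
    A * (2 * j + 1) ≤ A * 2 ^ r := Nat.mul_le_mul_left _ hj
    _ < 2 ^ r * 2 ^ r := Nat.mul_lt_mul_of_pos_right (by omega) (by positivity)
    _ = 2 ^ (2 * r) := by rw [← pow_add, two_mul]
    _ ≤ 2 ^ (M + 1) := Nat.pow_le_pow_right two_pos (by omega)
  have h : triangular (2 ^ (M + 1) * A + j) =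
      2 ^ M * (2 ^ (M + 1) * (A * A) + A * (2 * j + 1)) + triangular j := by
    have h₁ := two_mul_triangular (2 ^ (M + 1) * A + j)
    have h₂ := two_mul_triangular j
    have h₃ : (2 : ℕ) ^ (M + 1) = 2 * 2 ^ M := pow_succ' 2 M
    rw [h₃] at h₁ ⊢
    nlinarith
  rw [h, binOnes_two_pow_mul_add _ _ _ hjM, binOnes_two_pow_mul_add _ _ _ hlt,
    binOnes_mul_of_add_one_eq_two_pow hA hA' (by omega),
    binOnes_mul_of_add_one_eq_two_pow hA (by omega) hj, two_mul]

theorem exists_run_not_isVeryTriangular (k : ℕ) :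
    ∃ n, ∀ j ≤ k, ¬ IsVeryTriangular (triangular (n + j)) := by
  obtain ⟨u, hu⟩ : ∃ u, u = triangular k + 1 := ⟨_, rfl⟩
  obtain ⟨r, hr⟩ : ∃ r, r = u * (4 * u + 1) + 1 := ⟨_, rfl⟩
  obtain ⟨A, hA⟩ : ∃ A, A + 1 = 2 ^ r :=
    ⟨2 ^ r - 1, by have := Nat.one_le_two_pow (n := r); omega⟩
  refine ⟨2 ^ (2 * r + triangular k + 1) * A, fun j hj ⟨_, h⟩ => ?_⟩
  have hjk : triangular j ≤ triangular k := triangular_monotone hj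
  have hkr : 2 * k + 1 ≤ r := by
    have := le_triangular k
    nlinarith
  rw [binOnes_triangular_two_pow_mul_add hA (by omega)
    (by have := Nat.lt_two_pow_self (n := r); omega) (by omega)
    (hjk.trans_lt (Nat.lt_two_pow_self.trans_le (Nat.pow_le_pow_right two_pos (by omega))))] at h
  have hT : triangular (4 * u) + 2 = 2 * r := by
    have := two_mul_triangular (4 * u)
    rw [hr]
    nlinarith
  have hb := binOnes_le (triangular j)
  refine not_isTriangular_of_between (c := 4 * u) ?_ ?_ h
  · omega
  · rw [triangular_succ]
    omega

theorem stmt16 (k : ℕ) :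
    ∃ a b : ℕ, a < b ∧ IsVeryTriangular (triangular a) ∧ IsVeryTriangular (triangular b) ∧
      (∀ j : ℕ, a < j → j < b → ¬ IsVeryTriangular (triangular j)) ∧ b - a > k := by
  classical
  obtain ⟨n, hn⟩ := exists_run_not_isVeryTriangular k
  have hex := exists_isVeryTriangular_ge n
  have h0 : IsVeryTriangular (triangular 0) := ⟨⟨0, rfl⟩, 0, by simp [triangular, binOnes_zero]⟩
  obtain ⟨a, ha⟩ : ∃ a, a = Nat.findGreatest (fun i => IsVeryTriangular (triangular i)) n :=
    ⟨_, rfl⟩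
  have hav : IsVeryTriangular (triangular a) := by
    rw [ha]
    exact Nat.findGreatest_spec (P := fun i => IsVeryTriangular (triangular i)) (Nat.zero_le n) h0
  have han : a < n := by
    refine lt_of_le_of_ne (ha ▸ Nat.findGreatest_le n) ?_
    rintro rfl
    exact hn 0 (Nat.zero_le k) hav
  obtain ⟨hbn, hbv⟩ := Nat.find_spec hex
  have hbk : n + k < Nat.find hex := by
    by_contra! hle
    refine hn (Nat.find hex - n) (by omega) ?_
    rwa [Nat.add_sub_cancel' hbn]
  refine ⟨a, Nat.find hex, by omega, hav, hbv, fun j haj hjb hj => ?_, by omega⟩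
  rcases le_total n j with h | h
  · exact Nat.find_min hex hjb ⟨h, hj⟩
  · exact Nat.findGreatest_is_greatest (ha ▸ haj) h hj
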